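/- Let G = (S, T, π) be a countable two-person win-lose game (|S| = |T| = ℵ₀) such that the family B¹_down(G) is ascending-union closed. Then G satisfies the minimax property in the form: max over mixed strategies p on S of the inf over mixed strategies q on T of π^mix(p,q) equals the inf over mixed strategies q on T of the max over mixed strategies p on S of π^mix(p,q); in particular, for every q the supremum over p of π^mix(p,q) is attained, and the supremum over p of inf_q π^mix(p,q) is attained. -/

import Mathlib

open scoped ENNReal Classical

/-- The expected payoff to player 1 (probability that player 1 wins) when player 1
uses mixed strategy `p` and player 2 uses mixed strategy `q`. -/
noncomputable def mixedPayoff {S T : Type*} (π : S → T → Prop) (p : PMF S) (q : PMF T) : ℝ≥0∞ :=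
  ∑' s, ∑' t, p s * q t * (if π s t then 1 else 0)

/-- A family of sets is ascending-union closed if the union of every countable
strictly ascending chain of members of the family is again a member. -/
def AscendingUnionClosed {X : Type*} (F : Set (Set X)) : Prop :=
  ∀ A : ℕ → Set X, (∀ i, A i ∈ F) → (∀ i, A i ⊂ A (i + 1)) → (⋃ i, A i) ∈ F

/-- `B¹_down(G)`: the downward closure of the family of rows of the game. -/
def B1down {S T : Type*} (π : S → T → Prop) : Set (Set T) :=
  {A | ∃ s, A ⊆ {t | π s t}}

open MeasureTheory Set

/-- In a countable ground set, membership in a downward closed, ascending-union closed family can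
be tested on finite subsets. -/
theorem AscendingUnionClosed.mem_of_forall_finite_subset {X : Type*} [Countable X]
    {F : Set (Set X)} (hF : AscendingUnionClosed F) {A : Set X}
    (hA : ∀ D ⊆ A, D.Finite → D ∈ F) : A ∈ F := by
  rcases A.finite_or_infinite with hfin | hinf
  · exact hA A subset_rfl hfin
  have := hinf.to_subtype
  obtain ⟨_⟩ := nonempty_denumerable A
  let e : ℕ ≃ A := (Denumerable.eqv A).symm
  have he : Function.Injective fun i => (e i : X) := Subtype.val_injective.comp e.injective
  have hU : ⋃ n, (fun i => (e i : X)) '' Iio n = A := by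
    ext x
    simp only [mem_iUnion, mem_image, mem_Iio]
    refine ⟨?_, fun hx => ⟨e.symm ⟨x, hx⟩ + 1, e.symm ⟨x, hx⟩, Nat.lt_succ_self _, by simp⟩⟩
    rintro ⟨_, i, -, rfl⟩
    exact (e i).2
  rw [← hU]
  refine hF _ (fun n => hA _ ?_ ((finite_Iio n).image _)) fun n => ?_
  · rintro _ ⟨i, -, rfl⟩
    exact (e i).2
  · exact he.image_strictMono (Iio_ssubset_Iio (Nat.lt_succ_self n))

/-- The elements of `B1down π`, encoded as a subset of the Cantor space `T → Bool`. -/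
def cantorB1down {S T : Type*} (π : S → T → Prop) : Set (T → Bool) :=
  {a | {t | a t} ∈ B1down π}

section Compactness

variable {S T : Type*} {π : S → T → Prop}

theorem isClosed_cantorB1down [Countable T] (h : AscendingUnionClosed (B1down π)) :
    IsClosed (cantorB1down π) := by
  refine isClosed_of_closure_subset fun a ha => h.mem_of_forall_finite_subset fun D hD hfin => ?_
  have hopen : IsOpen {b : T → Bool | ∀ t ∈ D, b t = a t} := by
    simp only [ofPred_forall]
    exact hfin.isOpen_biInter fun t _ =>
      (isOpen_discrete ({a t} : Set Bool)).preimage (continuous_apply (A := fun _ => Bool) t)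
  obtain ⟨b, hb, s, hs⟩ := mem_closure_iff.1 ha _ hopen fun _ _ => rfl
  exact ⟨s, fun t ht => hs (by simpa [hb t ht] using hD ht)⟩

theorem compactSpace_cantorB1down [Countable T] (h : AscendingUnionClosed (B1down π)) :
    CompactSpace (cantorB1down π) :=
  isCompact_iff_compactSpace.1 (isClosed_cantorB1down h).isCompact

/-- The members of `cantorB1down π` that contain `t`. -/
def rowCylinder (π : S → T → Prop) (t : T) : Set (cantorB1down π) :=
  {a | a.1 t = true}

theorem isClopen_rowCylinder (t : T) : IsClopen (rowCylinder π t) :=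
  (isClopen_discrete {true}).preimage ((continuous_apply t).comp continuous_subtype_val)

theorem measurableSet_rowCylinder (t : T) : MeasurableSet (rowCylinder π t) :=
  measurableSet_eq_fun (f := fun a : cantorB1down π => a.1 t)
    ((measurable_pi_apply t).comp measurable_subtype_coe) measurable_const

/-- The row `B_s`, as a point of `cantorB1down π`. -/
noncomputable def rowPoint (π : S → T → Prop) (s : S) : cantorB1down π :=
  ⟨fun t => decide (π s t), s, by simp⟩

theorem rowPoint_mem_rowCylinder {s : S} {t : T} : rowPoint π s ∈ rowCylinder π t ↔ π s t := by
  simp [rowPoint, rowCylinder]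

end Compactness

/-- A finite form of the minimax theorem. -/
theorem exists_mem_convexHull_forall_lt {D : Type*} [Fintype D] [Nonempty D] {R : Set (D → ℝ)}
    (hR : R.Finite) {r : ℝ} (h : ∀ x ∈ stdSimplex ℝ D, ∃ y ∈ R, r < ∑ d, x d * y d) :
    ∃ y ∈ convexHull ℝ R, ∀ d, r < y d := by
  have hX : (stdSimplex ℝ D).Nonempty := ⟨_, single_mem_stdSimplex ℝ (Classical.arbitrary D)⟩
  have hx (y : D → ℝ) : IsLinearMap ℝ fun x : D → ℝ => ∑ d, x d * y d :=
    ⟨fun a b => by simp [add_mul, Finset.sum_add_distrib],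
      fun c a => by simp [Finset.mul_sum, mul_assoc]⟩
  have hy (x : D → ℝ) : IsLinearMap ℝ fun y : D → ℝ => ∑ d, x d * y d :=
    ⟨fun a b => by simp [mul_add, Finset.sum_add_distrib],
      fun c a => by simp [Finset.mul_sum, mul_left_comm]⟩
  obtain ⟨y, hyR, hlt⟩ := Sion.exists_lt_iInf_of_lt_iInf_of_finite (X := stdSimplex ℝ D)
    (Y := convexHull ℝ R) (f := fun x y => ∑ d, x d * y d) hX (isCompact_stdSimplex ℝ D)
    (fun y _ => (by fun_prop : Continuous fun x : D → ℝ => ∑ d, x d * y d)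
      |>.lowerSemicontinuous.lowerSemicontinuousOn _)
    (fun y _ => ((hx y).mk' _ |>.convexOn (convex_stdSimplex ℝ D)).quasiconvexOn)
    (convex_convexHull ℝ R)
    (fun x _ => (by fun_prop : Continuous fun y : D → ℝ => ∑ d, x d * y d)
      |>.upperSemicontinuous.upperSemicontinuousOn _)
    (fun x _ => ((hy x).mk' _ |>.concaveOn (convex_convexHull ℝ R)).quasiconcaveOn)
    (convex_stdSimplex ℝ D) hR (subset_convexHull ℝ R) h
  refine ⟨y, hyR, fun d => ?_⟩
  simpa [Pi.single_apply] using hlt _ (single_mem_stdSimplex ℝ d)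

section Measures

variable {S T : Type*} {π : S → T → Prop}

/-- The vectors of winning probabilities that are realised by random members of `B1down π` form a
convex set. -/
theorem convex_rowCylinder_measures (D : Set T) :
    Convex ℝ {y : D → ℝ | ∃ μ : ProbabilityMeasure (cantorB1down π),
      ∀ d : D, y d = (μ : Measure (cantorB1down π)).real (rowCylinder π d)} := by
  rintro y ⟨μ, hμ⟩ z ⟨ν, hν⟩ a b ha hb hab
  refine ⟨⟨ENNReal.ofReal a • (μ : Measure _) + ENNReal.ofReal b • (ν : Measure _), ⟨?_⟩⟩,
    fun d => ?_⟩
  · simp [← ENNReal.ofReal_add ha hb, hab]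
  · have h₁ : ENNReal.ofReal a * (μ : Measure _) (rowCylinder π d) ≠ ⊤ := by finiteness
    have h₂ : ENNReal.ofReal b * (ν : Measure _) (rowCylinder π d) ≠ ⊤ := by finiteness
    simp only [Pi.add_apply, Pi.smul_apply, smul_eq_mul, hμ, hν, measureReal_def,
      ProbabilityMeasure.coe_mk, Measure.add_apply, Measure.smul_apply, ENNReal.toReal_add h₁ h₂,
      ENNReal.toReal_mul, ENNReal.toReal_ofReal ha, ENNReal.toReal_ofReal hb]

theorem exists_probabilityMeasure_le_rowCylinder (D : Finset T) (hD : D.Nonempty) {r : ℝ}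
    (h : ∀ x ∈ stdSimplex ℝ D, ∃ s, r < ∑ d, x d * if π s d then 1 else 0) :
    ∃ μ : ProbabilityMeasure (cantorB1down π),
      ∀ d ∈ D, r ≤ (μ : Measure (cantorB1down π)).real (rowCylinder π d) := by
  have := hD.to_subtype
  let row : S → D → ℝ := fun s d => if π s d then 1 else 0
  have hfin : (range row).Finite := by
    refine (finite_range fun A : Set D => fun d : D => if d ∈ A then (1 : ℝ) else 0).subset ?_
    rintro _ ⟨s, rfl⟩
    exact ⟨{d | π s d}, rfl⟩
  obtain ⟨y, hy, hlt⟩ := exists_mem_convexHull_forall_lt hfin (r := r) fun x hx =>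
    (h x hx).elim fun s hs => ⟨row s, mem_range_self s, hs⟩
  obtain ⟨μ, hμ⟩ := convexHull_min (t := {y : D → ℝ | ∃ μ : ProbabilityMeasure (cantorB1down π),
      ∀ d : D, y d = (μ : Measure (cantorB1down π)).real (rowCylinder π d)}) (by
    rintro _ ⟨s, rfl⟩
    refine ⟨⟨Measure.dirac (rowPoint π s), inferInstance⟩, fun d => ?_⟩
    rw [measureReal_def, ProbabilityMeasure.coe_mk,
      Measure.dirac_apply' _ (measurableSet_rowCylinder (d : T))]
    simp [row, indicator_apply, rowPoint_mem_rowCylinder, apply_ite ENNReal.toReal])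
    (convex_rowCylinder_measures (D : Set T)) hy
  exact ⟨μ, fun d hd => (hlt ⟨d, hd⟩).le.trans_eq (hμ ⟨d, hd⟩)⟩

/-- Weak compactness: lower bounds on the winning probabilities that can be met approximately on
every finite set of columns can be met on all columns at once. -/
theorem exists_probabilityMeasure_forall_le [Countable T] [Nonempty T]
    (h : AscendingUnionClosed (B1down π))
    {v : ℝ} (hv : ∀ r < v, ∀ D : Finset T, D.Nonempty →
      ∃ μ : ProbabilityMeasure (cantorB1down π),
        ∀ d ∈ D, r ≤ (μ : Measure (cantorB1down π)).real (rowCylinder π d)) :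
    ∃ μ : ProbabilityMeasure (cantorB1down π),
      ∀ t, v ≤ (μ : Measure (cantorB1down π)).real (rowCylinder π t) := by
  have := compactSpace_cantorB1down h
  have hclosed (i : T × Iio v) : IsClosed {μ : ProbabilityMeasure (cantorB1down π) |
      (i.2 : ℝ) ≤ (μ : Measure (cantorB1down π)).real (rowCylinder π i.1)} := by
    refine isClosed_le continuous_const (continuous_iff_continuousAt.2 fun μ => ?_)
    exact (NNReal.continuous_coe.tendsto _).comp
      (ProbabilityMeasure.tendsto_measure_of_isClopen_of_tendsto Filter.tendsto_id
        (isClopen_rowCylinder i.1))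
  obtain ⟨μ, hμ⟩ := CompactSpace.iInter_nonempty hclosed fun I => by
    obtain ⟨r, hr⟩ := (I.image Prod.snd).exists_le
    obtain ⟨μ, hμ⟩ := hv r r.2 (insert (Classical.arbitrary T) (I.image Prod.fst))
      (Finset.insert_nonempty _ _)
    refine ⟨μ, mem_iInter₂.2 fun i hi => ?_⟩
    have hir : (i.2 : ℝ) ≤ r := hr i.2 (Finset.mem_image_of_mem _ hi)
    exact hir.trans (hμ _ (Finset.mem_insert_of_mem (Finset.mem_image_of_mem _ hi)))
  refine ⟨μ, fun t => le_of_forall_lt_imp_le_of_dense fun r hr => ?_⟩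
  exact mem_iInter.1 hμ (t, ⟨r, hr⟩)

/-- A random member of `B1down π` is dominated by a mixed strategy of player 1. -/
theorem exists_pmf_rowCylinder_le [Countable S] [Countable T]
    (μ : Measure (cantorB1down π)) [IsProbabilityMeasure μ] :
    ∃ p : PMF S, ∀ t, μ (rowCylinder π t) ≤ p.toOuterMeasure {s | π s t} := by
  obtain ⟨a₀, s₀, -⟩ : Nonempty (cantorB1down π) := μ.nonempty_of_neZero
  have : Nonempty S := ⟨s₀⟩
  obtain ⟨e, he⟩ := exists_surjective_nat S
  let dom (a : cantorB1down π) (n : ℕ) : Prop := ∀ t, a.1 t → π (e n) t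
  have hdom (a) : ∃ n, dom a n := by
    obtain ⟨a, s, hs⟩ := a
    obtain ⟨n, rfl⟩ := he s
    exact ⟨n, fun t ht => hs ht⟩
  have hmeas (n : ℕ) : MeasurableSet {a | dom a n} := by
    have : {a | dom a n} = ⋂ (t) (_ : ¬ π (e n) t), (rowCylinder π t)ᶜ := by
      ext a
      simp only [dom, rowCylinder, mem_ofPred_eq, mem_iInter, mem_compl_iff]
      exact forall_congr' fun t => not_imp_not.symm
    rw [this]
    exact .iInter fun t => .iInter fun _ => (measurableSet_rowCylinder t).compl
  let : MeasurableSpace S := ⊤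
  let f (a : cantorB1down π) : S := e (Nat.find (hdom a))
  have hf : Measurable f := (measurable_of_countable e).comp (measurable_find hdom hmeas)
  have := Measure.isProbabilityMeasure_map (μ := μ) hf.aemeasurable
  refine ⟨(μ.map f).toPMF, fun t => ?_⟩
  rw [← PMF.toMeasure_apply_eq_toOuterMeasure, Measure.toPMF_toMeasure,
    Measure.map_apply hf trivial]
  exact measure_mono fun a ha => Nat.find_spec (hdom a) t ha

end Measures

section Payoff

variable {S T : Type*} {π : S → T → Prop}

theorem mixedPayoff_eq_tsum_left (p : PMF S) (q : PMF T) :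
    mixedPayoff π p q = ∑' s, p s * q.toOuterMeasure {t | π s t} := by
  simp only [mixedPayoff, PMF.toOuterMeasure_apply, ← ENNReal.tsum_mul_left, indicator_apply,
    mem_ofPred_eq, mul_ite, mul_one, mul_zero]

theorem mixedPayoff_eq_tsum_right (p : PMF S) (q : PMF T) :
    mixedPayoff π p q = ∑' t, q t * p.toOuterMeasure {s | π s t} := by
  rw [mixedPayoff, ENNReal.tsum_comm]
  simp only [PMF.toOuterMeasure_apply, ← ENNReal.tsum_mul_left, indicator_apply,
    mem_ofPred_eq, mul_comm (p _), mul_ite, mul_one, mul_zero]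

theorem mixedPayoff_pure (s : S) (q : PMF T) :
    mixedPayoff π (PMF.pure s) q = q.toOuterMeasure {t | π s t} := by
  rw [mixedPayoff_eq_tsum_left, tsum_eq_single s fun s' hs' => by simp [hs']]
  simp

theorem PMF.tsum_mul_le {α : Type*} (p : PMF α) {f : α → ℝ≥0∞} {c : ℝ≥0∞} (hf : ∀ a, f a ≤ c) :
    ∑' a, p a * f a ≤ c :=
  (ENNReal.tsum_le_tsum fun a => mul_le_mul_right (hf a) (p a)).trans_eq <| by
    rw [ENNReal.tsum_mul_right, p.tsum_coe, one_mul]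

theorem PMF.le_tsum_mul {α : Type*} (p : PMF α) {f : α → ℝ≥0∞} {c : ℝ≥0∞} (hf : ∀ a, c ≤ f a) :
    c ≤ ∑' a, p a * f a :=
  (ENNReal.tsum_le_tsum fun a => mul_le_mul_right (hf a) (p a)).trans_eq' <| by
    rw [ENNReal.tsum_mul_right, p.tsum_coe, one_mul]

theorem mixedPayoff_le_one (p : PMF S) (q : PMF T) : mixedPayoff π p q ≤ 1 := by
  rw [mixedPayoff_eq_tsum_left]
  refine p.tsum_mul_le fun s => ?_
  rw [← q.tsum_coe, PMF.toOuterMeasure_apply]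
  exact ENNReal.tsum_le_tsum fun t => indicator_le_self _ _ _

theorem exists_isMax_toOuterMeasure [Countable T] [Nonempty S]
    (h : AscendingUnionClosed (B1down π)) (q : PMF T) :
    ∃ s, ∀ s', q.toOuterMeasure {t | π s' t} ≤ q.toOuterMeasure {t | π s t} := by
  have := compactSpace_cantorB1down h
  have : Nonempty (cantorB1down π) := ⟨rowPoint π (Classical.arbitrary S)⟩
  let w (a : cantorB1down π) : ℝ := ∑' t, (q t).toReal * if a.1 t then 1 else 0
  have hsum : Summable fun t => (q t).toReal := ENNReal.summable_toReal q.tsum_coe_ne_top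
  have hw : Continuous w := by
    refine continuous_tsum (fun t => ?_) hsum fun t a => ?_
    · exact continuous_const.mul ((continuous_of_discreteTopology
        (f := fun b : Bool => if b then (1 : ℝ) else 0)).comp
          ((continuous_apply t).comp continuous_subtype_val))
    · split_ifs <;> simp
  have hw' (a : cantorB1down π) : ENNReal.ofReal (w a) = q.toOuterMeasure {t | a.1 t} := by
    rw [PMF.toOuterMeasure_apply, ENNReal.ofReal_tsum_of_nonneg]
    · refine tsum_congr fun t => ?_
      by_cases ha : a.1 t <;> simp [ha, PMF.apply_ne_top]
    · intro t
      positivity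
    · refine hsum.of_nonneg_of_le (fun t => by positivity) fun t => ?_
      split_ifs <;> simp
  obtain ⟨a, -, ha⟩ := isCompact_univ.exists_isMaxOn univ_nonempty hw.continuousOn
  obtain ⟨s, hs⟩ := a.2
  refine ⟨s, fun s' => ?_⟩
  calc q.toOuterMeasure {t | π s' t} = ENNReal.ofReal (w (rowPoint π s')) := by
        simp [hw', rowPoint]
    _ ≤ ENNReal.ofReal (w a) := ENNReal.ofReal_le_ofReal (ha (mem_univ _))
    _ ≤ q.toOuterMeasure {t | π s t} := (hw' a).trans_le (q.toOuterMeasure.mono hs)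

/-- If no mixed strategy of player 2 holds player 1 below `v`, then no mixture of finitely many
columns does. -/
theorem exists_lt_sum_of_lt_toReal_iInf_iSup [Nonempty S] {r : ℝ}
    (hr : r < (⨅ q : PMF T, ⨆ p : PMF S, mixedPayoff π p q).toReal) (D : Finset T)
    {x : D → ℝ} (hx : x ∈ stdSimplex ℝ D) :
    ∃ s, r < ∑ d, x d * if π s d then 1 else 0 := by
  by_contra! hle
  have hnn (s) : 0 ≤ ∑ d, x d * if π s d then (1 : ℝ) else 0 :=
    Finset.sum_nonneg fun d _ => mul_nonneg (hx.1 d) (by positivity)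
  let q : PMF T := (PMF.ofFintype (fun d => ENNReal.ofReal (x d)) (by
    rw [← ENNReal.ofReal_sum_of_nonneg fun d _ => hx.1 d, hx.2, ENNReal.ofReal_one])).map
      (Subtype.val : D → T)
  have hq (s) : q.toOuterMeasure {t | π s t} ≤ ENNReal.ofReal r := by
    refine le_trans (le_of_eq ?_) (ENNReal.ofReal_le_ofReal (hle s))
    rw [PMF.toOuterMeasure_map_apply, PMF.toOuterMeasure_ofFintype_apply, tsum_fintype,
      ENNReal.ofReal_sum_of_nonneg fun d _ => mul_nonneg (hx.1 d) (by positivity)]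
    refine Finset.sum_congr rfl fun d _ => ?_
    by_cases hd : π s d <;> simp [hd]
  have hv : ⨅ q : PMF T, ⨆ p : PMF S, mixedPayoff π p q ≤ ENNReal.ofReal r :=
    (iInf_le _ q).trans <| iSup_le fun p => by
      rw [mixedPayoff_eq_tsum_left]
      exact p.tsum_mul_le hq
  exact hr.not_ge <| ENNReal.toReal_le_of_le_ofReal
    ((hnn (Classical.arbitrary S)).trans (hle _)) hv

end Payoff

/-- Theorem 2.2: in a countable game whose family `B¹_down(G)` is ascending-union
closed, `max_p inf_q = inf_q max_p`, with the maxima over `p` attained. -/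
theorem minimax_of_ascendingUnionClosed_B1down
    {S T : Type*} [Countable S] [Infinite S] [Countable T] [Infinite T]
    (π : S → T → Prop) (h : AscendingUnionClosed (B1down π)) :
    (⨆ p : PMF S, ⨅ q : PMF T, mixedPayoff π p q)
        = (⨅ q : PMF T, ⨆ p : PMF S, mixedPayoff π p q) ∧
    (∃ p : PMF S, (⨅ q : PMF T, mixedPayoff π p q)
        = ⨆ p' : PMF S, ⨅ q : PMF T, mixedPayoff π p' q) ∧
    (∀ q : PMF T, ∃ p : PMF S, mixedPayoff π p q = ⨆ p' : PMF S, mixedPayoff π p' q) := by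
  set v := ⨅ q : PMF T, ⨆ p : PMF S, mixedPayoff π p q with hv
  have hv_top : v ≠ ⊤ := ne_top_of_le_ne_top ENNReal.one_ne_top <|
    (iInf_le _ (PMF.pure (Classical.arbitrary T))).trans
      (iSup_le fun p => mixedPayoff_le_one p _)
  obtain ⟨μ, hμ⟩ := exists_probabilityMeasure_forall_le h (v := v.toReal) fun r hr D hD =>
    exists_probabilityMeasure_le_rowCylinder D hD fun x hx =>
      exists_lt_sum_of_lt_toReal_iInf_iSup hr D hx
  obtain ⟨p, hp⟩ := exists_pmf_rowCylinder_le (μ : Measure (cantorB1down π))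
  have hpv : v ≤ ⨅ q : PMF T, mixedPayoff π p q := le_iInf fun q => by
    rw [mixedPayoff_eq_tsum_right]
    exact q.le_tsum_mul fun t =>
      ((ENNReal.toReal_le_toReal hv_top (measure_ne_top _ _)).1 (hμ t)).trans (hp t)
  have hp_sup : ⨅ q : PMF T, mixedPayoff π p q ≤ ⨆ p' : PMF S, ⨅ q : PMF T, mixedPayoff π p' q :=
    le_iSup (fun p' : PMF S => ⨅ q : PMF T, mixedPayoff π p' q) p
  have hweak : ⨆ p' : PMF S, ⨅ q : PMF T, mixedPayoff π p' q ≤ v := iSup_iInf_le_iInf_iSup _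
  refine ⟨hweak.antisymm (hpv.trans hp_sup), ⟨p, hp_sup.antisymm (hweak.trans hpv)⟩, fun q => ?_⟩
  obtain ⟨s, hs⟩ := exists_isMax_toOuterMeasure h q
  refine ⟨PMF.pure s, (le_iSup (fun p' => mixedPayoff π p' q) _).antisymm (iSup_le fun p => ?_)⟩
  rw [mixedPayoff_pure, mixedPayoff_eq_tsum_left]
  exact p.tsum_mul_le hs
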